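/- Let 0 < μ < 1/4 and 0 < γ₀ ≤ 1. Let f, g : ℝ → ℝ be C³ functions and let (x, y) ∈ ℝ² satisfy: A := f(x) + g(y) ≥ (1 + μ)⁻², |f(x)| ≤ 2, |f'(x)| ≤ 2, |f''(x)| ≤ 2, |f'''(x)| ≤ 5, |g(y)| ≤ γ₀², |g'(y)| ≤ 2γ₀, |g''(y)| ≤ 2, and |g'''(y)| ≤ 24γ₀. Define K_x := (−f'''·A² + 2f'·g''·A + 4f'·f''·A − 3f'·g'² − 3f'³)/(2A⁴) and K_y := (−g'''·A² + 2f''·g'·A + 4g'·g''·A − 3f'²·g' − 3g'³)/(2A⁴) (all derivatives of f evaluated at x, of g at y). Then |K_x| ≤ 276 and |K_y| ≤ 288·γ₀. -/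

import Mathlib

/-- Both curvature partials of a Liouville metric have this numerator, with the roles of `f` and
`g` exchanged. -/
theorem abs_curvature_partial_numerator_le {A p q r s t P Q : ℝ} (hA : 0 ≤ A)
    (hp : |p| ≤ P) (hq : |q| ≤ Q) (hq2 : |q| ≤ 2) (hr : |r| ≤ 2) (hs : |s| ≤ 2) (ht : |t| ≤ 2) :
    |-p * A ^ 2 + 2 * q * r * A + 4 * q * s * A - 3 * q * t ^ 2 - 3 * q ^ 3| ≤
      P * A ^ 2 + Q * (12 * A + 24) := by
  have hfactor : |2 * r * A + 4 * s * A - 3 * t ^ 2 - 3 * q ^ 2| ≤ 12 * A + 24 := by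
    have hq4 : q ^ 2 ≤ 4 := by nlinarith [sq_abs q, abs_nonneg q]
    have ht4 : t ^ 2 ≤ 4 := by nlinarith [sq_abs t, abs_nonneg t]
    rw [abs_le] at hr hs ⊢
    constructor <;> nlinarith [mul_nonneg hA (sub_nonneg.2 hr.1), mul_nonneg hA (sub_nonneg.2 hr.2),
      mul_nonneg hA (sub_nonneg.2 hs.1), mul_nonneg hA (sub_nonneg.2 hs.2),
      sq_nonneg q, sq_nonneg t]
  calc |-p * A ^ 2 + 2 * q * r * A + 4 * q * s * A - 3 * q * t ^ 2 - 3 * q ^ 3|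
      = |-p * A ^ 2 + q * (2 * r * A + 4 * s * A - 3 * t ^ 2 - 3 * q ^ 2)| := by
        congr 1; ring
    _ ≤ |p| * A ^ 2 + |q| * |2 * r * A + 4 * s * A - 3 * t ^ 2 - 3 * q ^ 2| := by
        refine (abs_add_le _ _).trans_eq ?_
        rw [abs_mul, abs_mul, abs_neg, abs_of_nonneg (sq_nonneg A)]
    _ ≤ P * A ^ 2 + Q * (12 * A + 24) := by
        have hQ : 0 ≤ Q := (abs_nonneg q).trans hq
        gcongr

/-- The key curvature estimates in the paper's bound on the tail of the Melnikov
integral: under the stated bounds on `f`, `g` and their derivatives and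
`A = f(x) + g(y) ≥ (1 + μ)⁻²`, the curvature partials satisfy `|K_x| ≤ 276` and
`|K_y| ≤ 288 γ₀`. -/
theorem stmt13 (μ γ₀ : ℝ) (hμ0 : 0 < μ) (hμ1 : μ < 1 / 4)
    (hγ0 : 0 < γ₀) (hγ1 : γ₀ ≤ 1)
    (f g : ℝ → ℝ) (hf : ContDiff ℝ 3 f) (hg : ContDiff ℝ 3 g) (x y : ℝ)
    (hA : ((1 + μ) ^ 2)⁻¹ ≤ f x + g y)
    (hf0 : |f x| ≤ 2) (hf1 : |deriv f x| ≤ 2) (hf2 : |deriv (deriv f) x| ≤ 2)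
    (hf3 : |deriv (deriv (deriv f)) x| ≤ 5)
    (hg0 : |g y| ≤ γ₀ ^ 2) (hg1 : |deriv g y| ≤ 2 * γ₀) (hg2 : |deriv (deriv g) y| ≤ 2)
    (hg3 : |deriv (deriv (deriv g)) y| ≤ 24 * γ₀) :
    |(-(deriv (deriv (deriv f)) x) * (f x + g y) ^ 2 +
        2 * deriv f x * deriv (deriv g) y * (f x + g y) +
        4 * deriv f x * deriv (deriv f) x * (f x + g y) -
        3 * deriv f x * (deriv g y) ^ 2 - 3 * (deriv f x) ^ 3) /
      (2 * (f x + g y) ^ 4)| ≤ 276 ∧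
    |(-(deriv (deriv (deriv g)) y) * (f x + g y) ^ 2 +
        2 * deriv (deriv f) x * deriv g y * (f x + g y) +
        4 * deriv g y * deriv (deriv g) y * (f x + g y) -
        3 * (deriv f x) ^ 2 * deriv g y - 3 * (deriv g y) ^ 3) /
      (2 * (f x + g y) ^ 4)| ≤ 288 * γ₀ := by
  have hA' : 16 / 25 ≤ f x + g y := by
    refine le_trans ?_ hA
    rw [le_inv_comm₀ (by norm_num) (by positivity)]
    nlinarith
  have hg1' : |deriv g y| ≤ 2 := by linarith
  have hKx := abs_curvature_partial_numerator_le (A := f x + g y) (by linarith)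
    hf3 hf1 hf1 hg2 hf2 hg1'
  have hKy := abs_curvature_partial_numerator_le (A := f x + g y) (by linarith)
    hg3 hg1 hg1' hf2 hg2 hf1
  generalize f x + g y = A at *
  have hA0 : 0 < A := by linarith
  have hA2 : 16 / 25 * A ≤ A ^ 2 := by nlinarith
  have hA4 : (16 / 25) ^ 2 * A ^ 2 ≤ A ^ 4 := by nlinarith [sq_nonneg A]
  have hden : |2 * A ^ 4| = 2 * A ^ 4 := abs_of_pos (by positivity)
  constructor
  · rw [abs_div, hden, div_le_iff₀ (by positivity)]
    linarith
  · rw [abs_div, hden, div_le_iff₀ (by positivity)]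
    have hpoly : 24 * A ^ 2 + 24 * A + 48 ≤ 576 * A ^ 4 := by linarith
    calc _ = _ := by congr 1; ring
      _ ≤ _ := hKy
      _ = γ₀ * (24 * A ^ 2 + 24 * A + 48) := by ring
      _ ≤ γ₀ * (576 * A ^ 4) := by gcongr
      _ = 288 * γ₀ * (2 * A ^ 4) := by ring
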